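/- Let Σ = {σ₁,…,σₙ} be a finite family of injective non-unital ring endomorphisms of a ring R with R Σ-semicommutative and Baer, and let Δ = {δ₁,…,δₙ} be a family of maps where each δᵢ is a σᵢ-derivation of R. Then for every nonempty subset S of R and every β ∈ ℕⁿ, l_R(S) ⊆ l_R(δ^β(S)), where δ^β(S) = {δ^β(s) : s ∈ S}. -/

import Mathlib

/-- A non-unital ring endomorphism: an additive and multiplicative map
(not required to send `1` to `1`). -/
def IsNUEnd {R : Type*} [Ring R] (σ : R → R) : Prop :=
  (∀ a b : R, σ (a + b) = σ a + σ b) ∧ (∀ a b : R, σ (a * b) = σ a * σ b)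

/-- For a family `σ : Fin n → R → R` and `α ∈ ℕⁿ`, the composition
`σ₁^{α₁} ∘ ⋯ ∘ σₙ^{αₙ}`. -/
def famPow {R : Type*} {n : ℕ} (σ : Fin n → R → R) (α : Fin n → ℕ) : R → R :=
  (List.ofFn (fun i => (σ i)^[α i])).foldr (· ∘ ·) id

/-- `R` is `Σ`-semicommutative: `a * b = 0` implies `a * r * σ^α(b) = 0`
for every `r ∈ R` and every `α ≠ 0`. -/
def SigmaSemicomm {R : Type*} [Ring R] {n : ℕ} (σ : Fin n → R → R) : Prop :=
  ∀ a b : R, a * b = 0 → ∀ r : R, ∀ α : Fin n → ℕ, α ≠ 0 → a * r * famPow σ α b = 0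

/-- `R` is `σ`-semicommutative (single endomorphism). -/
def SingleSemicomm {R : Type*} [Ring R] (σ : R → R) : Prop :=
  ∀ a b : R, a * b = 0 → ∀ r : R, a * r * σ b = 0

/-- `R` is `Σ`-rigid: `a * σ^α(a) = 0` implies `a = 0`. -/
def SigmaRigid {R : Type*} [Ring R] {n : ℕ} (σ : Fin n → R → R) : Prop :=
  ∀ (a : R) (α : Fin n → ℕ), a * famPow σ α a = 0 → a = 0

/-- `δ` is a `σ`-derivation of `R`. -/
def IsSigmaDerivation {R : Type*} [Ring R] (σ δ : R → R) : Prop :=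
  (∀ a b : R, δ (a + b) = δ a + δ b) ∧
    (∀ a b : R, δ (a * b) = σ a * δ b + δ a * b)

/-- The left annihilator `l_R(S)` of a subset `S ⊆ R`. -/
def leftAnn {R : Type*} [Ring R] (S : Set R) : Set R :=
  {x : R | ∀ s ∈ S, x * s = 0}

/-- The right annihilator `r_R(S)` of a subset `S ⊆ R`. -/
def rightAnn {R : Type*} [Ring R] (S : Set R) : Set R :=
  {x : R | ∀ s ∈ S, s * x = 0}

/-- `R` is Baer (left annihilator version): the left annihilator of every
nonempty subset is of the form `Re` for an idempotent `e`. -/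
def IsBaerLeft (R : Type*) [Ring R] : Prop :=
  ∀ S : Set R, S.Nonempty →
    ∃ e : R, e * e = e ∧ leftAnn S = {x : R | ∃ r : R, x = r * e}

/-- `R` is Baer (right annihilator version): the right annihilator of every
nonempty subset is of the form `eR` for an idempotent `e`. -/
def IsBaerRight (R : Type*) [Ring R] : Prop :=
  ∀ S : Set R, S.Nonempty →
    ∃ e : R, e * e = e ∧ rightAnn S = {x : R | ∃ r : R, x = e * r}

/-- `R` is quasi-Baer: the right annihilator of every right ideal
(an additive subgroup closed under right multiplication) is of the form `eR`
for an idempotent `e`. -/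
def IsQuasiBaer (R : Type*) [Ring R] : Prop :=
  ∀ I : AddSubgroup R, (∀ a ∈ I, ∀ r : R, a * r ∈ I) →
    ∃ e : R, e * e = e ∧ rightAnn (I : Set R) = {x : R | ∃ r : R, x = e * r}

theorem famPow_succ {R : Type*} {n : ℕ} (σ : Fin (n + 1) → R → R) (α : Fin (n + 1) → ℕ) :
    famPow σ α = (σ 0)^[α 0] ∘ famPow (fun i => σ i.succ) (fun i => α i.succ) := by
  simp [famPow, List.ofFn_succ]

theorem famPow_zero {R : Type*} {n : ℕ} (σ : Fin n → R → R) :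
    famPow σ (fun _ => 0) = id := by
  induction n with
  | zero => simp [famPow]
  | succ n ih => rw [famPow_succ, ih]; rfl

theorem famPow_single {R : Type*} {n : ℕ} (σ : Fin n → R → R) (i : Fin n) :
    famPow σ (Pi.single i 1) = σ i := by
  induction n with
  | zero => exact i.elim0
  | succ n ih =>
    rw [famPow_succ]
    cases i using Fin.cases with
    | zero => simp [famPow_zero]
    | succ j =>
      have h : (fun k : Fin n => (Pi.single j.succ 1 : Fin (n + 1) → ℕ) k.succ) =
          Pi.single j 1 := by
        funext k
        simp [Pi.single_apply]
      rw [h, ih]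
      simp

/-- A property of elements preserved by every member of a family is preserved by `famPow`. -/
theorem famPow_induction {R : Type*} {n : ℕ} {δ : Fin n → R → R} {p : R → Prop}
    (h : ∀ i x, p x → p (δ i x)) (β : Fin n → ℕ) {x : R} (hx : p x) :
    p (famPow δ β x) := by
  induction n with
  | zero => simpa [famPow] using hx
  | succ n ih =>
    rw [famPow_succ]
    exact Function.Iterate.rec p (ih (fun i => h i.succ) _) (h 0) (β 0)

theorem SigmaSemicomm.singleSemicomm {R : Type*} [Ring R] {n : ℕ} {σ : Fin n → R → R}
    (h : SigmaSemicomm σ) (i : Fin n) : SingleSemicomm (σ i) := by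
  intro a b hab r
  have hi : (Pi.single i 1 : Fin n → ℕ) ≠ 0 := by simp
  simpa [famPow_single] using h a b hab r _ hi

theorem IsNUEnd.map_zero {R : Type*} [Ring R] {σ : R → R} (h : IsNUEnd σ) : σ 0 = 0 := by
  simpa using h.1 0 0

theorem IsSigmaDerivation.map_zero {R : Type*} [Ring R] {σ δ : R → R}
    (h : IsSigmaDerivation σ δ) : δ 0 = 0 := by
  simpa using h.1 0 0

/-- If `σ` is injective and `R` is `σ`-semicommutative, then `e R f = 0` for every idempotent `e`
and every `f` with `e * f = 0`. -/
theorem SingleSemicomm.idempotent_mul_mul_eq_zero {R : Type*} [Ring R] {σ : R → R}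
    (hsc : SingleSemicomm σ) (hσ : IsNUEnd σ) (hinj : Function.Injective σ) {e f : R}
    (he : e * e = e) (hef : e * f = 0) (r : R) : e * r * f = 0 := by
  apply hinj
  have h : σ e = e * σ e := by
    have := hsc (1 - e) e (by rw [sub_mul, one_mul, he, sub_self]) 1
    rw [mul_one, sub_mul, one_mul] at this
    exact sub_eq_zero.mp this
  rw [hσ.2, hσ.2, hσ.map_zero, h, mul_assoc e]
  exact hsc e f hef _

theorem SingleSemicomm.commute_of_idempotent {R : Type*} [Ring R] {σ : R → R}
    (hsc : SingleSemicomm σ) (hσ : IsNUEnd σ) (hinj : Function.Injective σ) {e : R}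
    (he : e * e = e) (r : R) : e * r = r * e := by
  have h₁ : e * (1 - e) = 0 := by rw [mul_sub, mul_one, he, sub_self]
  have h₂ : (1 - e) * e = 0 := by rw [sub_mul, one_mul, he, sub_self]
  have h₃ := hsc.idempotent_mul_mul_eq_zero hσ hinj he h₁ r
  have h₄ := hsc.idempotent_mul_mul_eq_zero hσ hinj (by rw [mul_sub, mul_one, h₂, sub_zero]) h₂ r
  rw [mul_sub, mul_one, sub_eq_zero] at h₃
  rw [sub_mul, sub_mul, one_mul, sub_eq_zero] at h₄
  exact h₃.trans h₄.symm

theorem SingleSemicomm.mul_derivation_eq_zero {R : Type*} [Ring R] {σ δ : R → R}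
    (hsc : SingleSemicomm σ) (hσ : IsNUEnd σ) (hinj : Function.Injective σ)
    (hδ : IsSigmaDerivation σ δ) (hB : IsBaerLeft R) {a b : R} (hab : a * b = 0) :
    a * δ b = 0 := by
  obtain ⟨e, he, hann⟩ := hB {b} (Set.singleton_nonempty b)
  have hc := hsc.commute_of_idempotent hσ hinj he
  have heb : e * b = 0 := by
    have : e ∈ leftAnn {b} := hann ▸ ⟨e, he.symm⟩
    exact this b rfl
  obtain ⟨r, rfl⟩ : ∃ r, a = r * e := by
    have : a ∈ leftAnn {b} := by
      rintro s rfl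
      exact hab
    rwa [hann] at this
  have hkill (x : R) : e * (x * b) = 0 := by
    rw [← mul_assoc, hc, mul_assoc, heb, mul_zero]
  have hσe : e * σ e = e * σ 1 := by
    have := hsc e (1 - e) (by rw [mul_sub, mul_one, he, sub_self]) 1
    have h : σ 1 = σ e + σ (1 - e) := by rw [← hσ.1, add_sub_cancel]
    rw [mul_one] at this
    rw [h, mul_add, this, add_zero]
  have h₁ : e * (σ e * δ b) = 0 := by
    have := congrArg (e * ·) (hδ.2 e b)
    simpa [heb, hδ.map_zero, mul_add, hkill] using this.symm
  have h₂ : e * δ b = 0 := by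
    have := hδ.2 1 b
    rw [one_mul] at this
    rw [this, mul_add, hkill, add_zero, ← mul_assoc, ← hσe, mul_assoc, h₁]
  rw [mul_assoc, h₂, mul_zero]


/-- in a `Σ`-semicommutative Baer ring with `σᵢ`-derivations
`δᵢ`, one has `l_R(S) ⊆ l_R(δ^β(S))` for every nonempty `S` and every `β`. -/
theorem sigma_semicomm_baer_leftAnn_delta {R : Type*} [Ring R] {n : ℕ}
    (σ : Fin n → R → R) (δ : Fin n → R → R)
    (hσ : ∀ i, IsNUEnd (σ i)) (hinj : ∀ i, Function.Injective (σ i))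
    (hδ : ∀ i, IsSigmaDerivation (σ i) (δ i))
    (hsc : SigmaSemicomm σ) (hB : IsBaerLeft R) :
    ∀ S : Set R, S.Nonempty → ∀ β : Fin n → ℕ,
      leftAnn S ⊆ leftAnn (famPow δ β '' S) := by
  rintro S - β a ha _ ⟨s, hs, rfl⟩
  exact famPow_induction (p := fun x => a * x = 0)
    (fun i _ hx => (hsc.singleSemicomm i).mul_derivation_eq_zero (hσ i) (hinj i) (hδ i) hB hx)
    β (ha s hs)
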